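/- Let K ⊆ ℝ^d be a d-dimensional compact convex set that can be covered by finitely many homothetic copies of K (sets of the form α + λK with α ∈ ℝ^d and λ > 0) whose interiors are pairwise disjoint, with at least two copies. Then K is a parallelepiped, i.e., a translate of the convex hull of the points ±e_1 ± ⋯ ± e_d for some ℝ-basis e_1, …, e_d of ℝ^d. -/

import Mathlib

open Set

noncomputable section

/-- `K` is a parallelepiped: a translate of the convex hull of the `2^d` points
    `±e_1 ± ⋯ ± e_d` for some `ℝ`-basis `e_1, …, e_d` of `ℝ^d`. -/
def IsParallelepiped {d : ℕ} (K : Set (Fin d → ℝ)) : Prop :=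
  ∃ (x : Fin d → ℝ) (e : Fin d → Fin d → ℝ), LinearIndependent ℝ e ∧
    K = convexHull ℝ
      {p : Fin d → ℝ | ∃ ε : Fin d → ℝ, (∀ i, ε i = 1 ∨ ε i = -1) ∧
        p = x + ∑ i, ε i • e i}

section groemer

/-- The tiling data, unpacked. -/
structure GTiling {E : Type*} [NormedAddCommGroup E] [NormedSpace ℝ E] (K : Set E) (n : ℕ)
    (a : Fin n → E) (lam : Fin n → ℝ) : Prop where
  comp : IsCompact K
  conv : Convex ℝ K
  int : (interior K).Nonempty
  pos : ∀ i, 0 < lam i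
  mem : ∀ i, ∀ x ∈ K, a i + lam i • x ∈ K
  memint : ∀ i, ∀ x ∈ interior K, a i + lam i • x ∈ interior K
  cov : ∀ x ∈ K, ∃ i, ∃ y ∈ K, x = a i + lam i • y
  disj : ∀ i j, i ≠ j → ∀ x ∈ interior K, ∀ y ∈ interior K, a i + lam i • x ≠ a j + lam j • y
  two : ∀ i : Fin n, ∃ j, j ≠ i

/-- `z` is a direction pointing from `v` into `K`. -/
def GT {E : Type*} [NormedAddCommGroup E] [NormedSpace ℝ E] (K : Set E) (v z : E) : Prop :=
  ∃ t : ℝ, 0 < t ∧ v + t • z ∈ K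

variable {E : Type*} [NormedAddCommGroup E] [NormedSpace ℝ E] {K : Set E} {n : ℕ}
    {a : Fin n → E} {lam : Fin n → ℝ}

theorem GTiling.centre (hT : GTiling K n a lam) {v : E} (hv : v ∈ K.exposedPoints ℝ) :
    ∃ i, a i + lam i • v = v := by
  obtain ⟨hvK, u, hu⟩ := hv
  obtain ⟨i, y, hy, h⟩ := hT.cov v hvK
  refine ⟨i, ?_⟩
  have h1 := (hu _ (hT.mem i v hvK)).1
  have h2 := congrArg u h
  simp only [map_add, map_smul, smul_eq_mul] at h1 h2
  have h3 : u v ≤ u y := by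
    have := hT.pos i
    by_contra hc
    push Not at hc
    nlinarith
  have := (hu y hy).2 h3
  rw [this] at h
  exact h.symm

theorem GTiling.ne_one (hT : GTiling K n a lam) {v : E} {i : Fin n}
    (h : a i + lam i • v = v) : lam i ≠ 1 := by
  intro h1
  rw [h1, one_smul] at h
  have ha : a i = 0 := by simpa using h
  obtain ⟨q, hq⟩ := hT.int
  obtain ⟨j, hj⟩ := hT.two i
  refine hT.disj i j hj.symm _ (hT.memint j q hq) q hq ?_
  rw [ha, h1]; simp

theorem GTiling.finite_exposed (hT : GTiling K n a lam) : (K.exposedPoints ℝ).Finite := by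
  have h : ∀ v : K.exposedPoints ℝ, ∃ i, a i + lam i • (v : E) = v := fun v => hT.centre v.2
  choose f hf using h
  have hinj : Function.Injective f := by
    intro v w hvw
    have h1 := hf v
    have h2 := hf w
    rw [← hvw] at h2
    have h3 : (1 - lam (f v)) • ((v : E) - w) = 0 := by
      have : (v : E) - w = lam (f v) • ((v : E) - w) := by
        conv_lhs => rw [← h1, ← h2]
        module
      rw [sub_smul, one_smul, sub_eq_zero]; exact this
    rcases smul_eq_zero.1 h3 with h4 | h4
    · exact absurd (by linarith) (hT.ne_one h1)
    · exact Subtype.ext (sub_eq_zero.1 h4)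
  have := Finite.of_injective f hinj
  exact Set.toFinite _

/-- Local analysis at the far endpoint of the tile centred at `v`, on an exposed edge. -/
theorem GTiling.edge_core (hT : GTiling K n a lam) {v e : E} (hv : v ∈ K.exposedPoints ℝ)
    (he : e ≠ 0) (hw : v + e ∈ K) (φ : E →L[ℝ] ℝ) (hφe : φ e = 0)
    (hφ : ∀ x ∈ K, φ x ≤ φ v)
    (hface : ∀ x ∈ K, φ x = φ v → ∃ t : ℝ, 0 ≤ t ∧ t ≤ 1 ∧ x = v + t • e) :
    ∃ h : E →L[ℝ] ℝ, h e = 1 ∧ (∀ x ∈ K, 0 ≤ h (x - v) ∧ h (x - v) ≤ 1) ∧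
      ∀ z, GT K v z → ∀ δ : ℝ, 0 < δ →
        GT K v (z - (h z - δ) • e) ∧ GT K (v + e) (z - (h z + δ) • e) := by
  have hvK : v ∈ K := hv.1
  obtain ⟨i, hi⟩ := hT.centre hv
  have smul_inj : ∀ s t : ℝ, s • e = t • e → s = t := fun s t h => smul_left_injective ℝ he h
  have hli0 := hT.pos i
  -- `lam i < 1`
  have hai : a i = v - lam i • v := by rw [eq_sub_iff_add_eq]; exact hi
  have hpi : a i + lam i • (v + e) = v + lam i • e := by rw [hai]; module
  have hpK : v + lam i • e ∈ K := by rw [← hpi]; exact hT.mem i _ hw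
  have hli1 : lam i < 1 := by
    obtain ⟨t, ht0, ht1, ht⟩ := hface _ hpK (by simp [hφe])
    have := smul_inj _ _ (add_left_cancel ht)
    exact lt_of_le_of_ne (by linarith) (hT.ne_one hi)
  obtain ⟨p, hp⟩ : ∃ p, p = v + lam i • e := ⟨_, rfl⟩
  rw [← hp] at hpK hpi
  have hφp : φ p = φ v := by simp [hp, hφe]
  -- tiles meeting `p`
  have claim0 : ∀ j y, y ∈ K → p = a j + lam j • y → y = v ∨ (j = i ∧ y = v + e) := by
    intro j y hy hpy
    have hlj := hT.pos j
    have h1 : φ y = φ v := by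
      refine le_antisymm (hφ y hy) ?_
      have h1 := hφ _ (hT.mem j v hvK)
      have h2 := congrArg φ hpy
      simp only [map_add, map_smul, smul_eq_mul] at h1 h2
      by_contra hc
      push Not at hc
      nlinarith
    obtain ⟨t, ht0, ht1, ht⟩ := hface y hy h1
    by_cases hji : j = i
    · right
      refine ⟨hji, ?_⟩
      subst hji
      have : lam j • (v + e) = lam j • y := by
        rw [← hpi] at hpy; exact add_left_cancel hpy
      exact (smul_right_injective E hlj.ne' this).symm
    · left
      rcases ht0.eq_or_lt with h0 | h0
      · rw [ht, ← h0]; simp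
      exfalso
      obtain ⟨q, hq⟩ := hT.int
      obtain ⟨s, hs⟩ : ∃ s, s = min (lam i) (lam j * t) := ⟨_, rfl⟩
      have hs0 : 0 < s := by rw [hs]; exact lt_min hli0 (mul_pos hlj h0)
      have hs1 : s ≤ lam i := by rw [hs]; exact min_le_left _ _
      have hs2 : s ≤ lam j * t := by rw [hs]; exact min_le_right _ _
      have hA := hT.conv.add_smul_sub_mem_interior hw hq (t := s / lam i)
        ⟨div_pos hs0 hli0, (div_le_one hli0).2 hs1⟩
      have hB := hT.conv.add_smul_sub_mem_interior hw hq (t := s / (lam j * t))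
        ⟨div_pos hs0 (mul_pos hlj h0), (div_le_one (mul_pos hlj h0)).2 hs2⟩
      have hC := hT.conv.add_smul_sub_mem_interior hvK hB (t := t) ⟨h0, ht1⟩
      refine hT.disj j i hji _ hC _ hA ?_
      have e1 : a j = p - lam j • y := by rw [hpy]; abel
      have e2 : a i = p - lam i • (v + e) := by rw [← hpi]; abel
      rw [e1, e2, ht]
      match_scalars <;> field_simp <;> ring
  have claim1 : ∀ z, GT K p z → ∃ j y, y ∈ K ∧ p = a j + lam j • y ∧ GT K y z := by
    rintro z ⟨t, ht, htz⟩
    have hcl : ∀ j, IsClosed ((fun y => a j + lam j • y) '' K) := fun j =>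
      (hT.comp.image (by fun_prop)).isClosed
    have hev : ∀ᶠ s : ℝ in nhdsWithin 0 (Ioi 0), ∀ j, p + s • z ∈ (fun y => a j + lam j • y) '' K →
        p ∈ (fun y => a j + lam j • y) '' K := by
      rw [Filter.eventually_all]
      intro j
      by_cases hpj : p ∈ (fun y => a j + lam j • y) '' K
      · exact Filter.Eventually.of_forall fun _ _ => hpj
      · have hc : Filter.Tendsto (fun s : ℝ => p + s • z) (nhdsWithin 0 (Ioi 0)) (nhds p) := by
          have : Filter.Tendsto (fun s : ℝ => p + s • z) (nhds 0) (nhds (p + (0:ℝ) • z)) :=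
            (by fun_prop : Continuous fun s : ℝ => p + s • z).tendsto 0
          rw [zero_smul, add_zero] at this
          exact this.mono_left nhdsWithin_le_nhds
        filter_upwards [hc ((hcl j).isOpen_compl.mem_nhds hpj)] with s hs h
        exact absurd h hs
    have hev2 : ∀ᶠ s : ℝ in nhdsWithin 0 (Ioi 0), 0 < s ∧ s ≤ t := by
      filter_upwards [Ioc_mem_nhdsGT ht] with s hs using hs
    obtain ⟨s, h1, hs0, hst⟩ := (hev.and hev2).exists
    have hsK : p + s • z ∈ K := by
      have := hT.conv.add_smul_mem hpK htz (t := s / t) ⟨by positivity, (div_le_one ht).2 hst⟩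
      rw [smul_smul, div_mul_cancel₀ _ ht.ne'] at this
      exact this
    obtain ⟨j, y', hy', hj⟩ := hT.cov _ hsK
    obtain ⟨y, hy, hyp⟩ := h1 j ⟨y', hy', hj.symm⟩
    have hlj := hT.pos j
    refine ⟨j, y, hy, hyp.symm, s / lam j, div_pos hs0 hlj, ?_⟩
    have : y + (s / lam j) • z = y' := by
      apply smul_right_injective E hlj.ne'
      apply add_left_cancel (a := a j)
      show a j + lam j • (y + (s / lam j) • z) = a j + lam j • y'
      rw [← hj, ← hyp, smul_add, smul_smul, mul_div_cancel₀ _ hlj.ne', add_assoc]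
    rw [this]; exact hy'
  have claim1' : ∀ z, GT K p z → GT K v z ∨ GT K (v + e) z := by
    intro z hz
    obtain ⟨j, y, hy, hpy, h⟩ := claim1 z hz
    rcases claim0 j y hy hpy with rfl | ⟨-, rfl⟩
    · exact Or.inl h
    · exact Or.inr h
  -- the neighbouring tile
  obtain ⟨j, hji, hpj⟩ : ∃ j, j ≠ i ∧ p = a j + lam j • v := by
    obtain ⟨j, y, hy, hpy, s, hs, hsK⟩ := claim1 e ⟨1 - lam i, by linarith, by
      have : p + (1 - lam i) • e = v + e := by rw [hp]; module
      rw [this]; exact hw⟩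
    rcases claim0 j y hy hpy with rfl | ⟨-, rfl⟩
    · refine ⟨j, ?_, hpy⟩
      rintro rfl
      rw [hi, hp] at hpy
      have : lam j • e = 0 := by simpa using hpy
      rcases smul_eq_zero.1 this with h | h
      · linarith
      · exact he h
    · exfalso
      obtain ⟨t, ht0, ht1, ht⟩ := hface _ hsK (by simp [hφe])
      have : (1 + s) • e = t • e := by
        apply add_left_cancel (a := v)
        rw [← ht]; module
      have := smul_inj _ _ this
      linarith
  have hlj := hT.pos j
  have claim2 : ∀ q ∈ interior K, ∀ q' ∈ interior K, ∀ c : ℝ, 0 < c →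
      q' - v = c • (q - (v + e)) → False := by
    intro q hq q' hq' c hc hqq
    obtain ⟨s, hs⟩ : ∃ s, s = min (lam i) (lam j * c) := ⟨_, rfl⟩
    have hjc := mul_pos hlj hc
    have hs0 : 0 < s := by rw [hs]; exact lt_min hli0 hjc
    have hs1 : s ≤ lam i := by rw [hs]; exact min_le_left _ _
    have hs2 : s ≤ lam j * c := by rw [hs]; exact min_le_right _ _
    have hA := hT.conv.add_smul_sub_mem_interior hw hq (t := s / lam i)
      ⟨div_pos hs0 hli0, (div_le_one hli0).2 hs1⟩
    have hB := hT.conv.add_smul_sub_mem_interior hvK hq' (t := s / (lam j * c))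
      ⟨div_pos hs0 hjc, (div_le_one hjc).2 hs2⟩
    refine hT.disj j i hji _ hB _ hA ?_
    have e1 : a j = p - lam j • v := by rw [hpj]; abel
    have e2 : a i = p - lam i • (v + e) := by rw [← hpi]; abel
    rw [e1, e2, hqq]
    match_scalars <;> field_simp <;> ring
  -- separation
  obtain ⟨h, hpos, hle⟩ : ∃ h : E →L[ℝ] ℝ, (∀ q ∈ interior K, 0 < h (q - v)) ∧
      ∀ q ∈ interior K, h (q - (v + e)) ≤ 0 := by
    have hAo : IsOpen ((fun q => q + v) ⁻¹' interior K) :=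
      isOpen_interior.preimage (by fun_prop)
    have hAc : Convex ℝ ((fun q => q + v) ⁻¹' interior K) :=
      hT.conv.interior.translate_preimage_left v
    have hBc : Convex ℝ {z : E | ∃ c : ℝ, 0 < c ∧ ∃ q ∈ interior K, z = c • (q - (v + e))} := by
      rw [convex_iff_forall_pos]
      rintro _ ⟨c, hc, q, hq, rfl⟩ _ ⟨c', hc', q', hq', rfl⟩ α β hα hβ hαβ
      have h1 := mul_pos hα hc
      have h2 := mul_pos hβ hc'
      refine ⟨α * c + β * c', by positivity, (α * c / (α * c + β * c')) • q +
        (β * c' / (α * c + β * c')) • q', ?_, ?_⟩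
      · exact hT.conv.interior hq hq' (by positivity) (by positivity) (by field_simp)
      · match_scalars <;> field_simp <;> ring
    obtain ⟨f, u, hf1, hf2⟩ := geometric_hahn_banach_open hAc hAo hBc (by
      rw [Set.disjoint_left]
      rintro z hz ⟨c, hc, q, hq, rfl⟩
      exact claim2 q hq _ hz c hc (add_sub_cancel_right _ _))
    have hB : ∀ q ∈ interior K, ∀ c : ℝ, 0 < c → u ≤ c * f (q - (v + e)) := by
      intro q hq c hc
      have := hf2 _ ⟨c, hc, q, hq, rfl⟩
      simpa only [map_smul, smul_eq_mul] using this
    have hu : u ≤ 0 := by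
      obtain ⟨q, hq⟩ := hT.int
      by_contra hc
      push Not at hc
      have h0 : 0 < f (q - (v + e)) := by
        have := hB q hq 1 one_pos; linarith
      have := hB q hq (u / (2 * f (q - (v + e)))) (by positivity)
      have h3 : u / (2 * f (q - (v + e))) * f (q - (v + e)) = u / 2 := by field_simp
      linarith
    refine ⟨-f, ?_, ?_⟩
    · intro q hq
      have := hf1 (q - v) (by simpa using hq)
      simp only [neg_apply]; linarith
    · intro q hq
      simp only [neg_apply]
      by_contra hc
      push Not at hc
      obtain ⟨X, hX⟩ : ∃ X, X = f (q - (v + e)) := ⟨_, rfl⟩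
      rw [← hX] at hc
      have hX0 : X < 0 := by linarith
      have := hB q hq ((1 - u) / (-X)) (by apply div_pos <;> linarith)
      rw [← hX] at this
      have h3 : (1 - u) / (-X) * X = u - 1 := by
        have := hX0.ne
        field_simp; ring
      linarith
  have hhe : 0 < h e := by
    obtain ⟨q, hq⟩ := hT.int
    have h1 := hpos q hq
    have h2 := hle q hq
    have : h (q - (v + e)) = h (q - v) - h e := by simp; ring
    linarith
  have hKcl : K ⊆ closure (interior K) := by
    rw [hT.conv.closure_interior_eq_closure_of_nonempty_interior hT.int]; exact subset_closure
  have hK1 : ∀ x ∈ K, 0 ≤ h (x - v) := by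
    intro x hx
    have hc : IsClosed {x | 0 ≤ h (x - v)} := isClosed_le continuous_const (by fun_prop)
    exact closure_minimal (fun q hq => (hpos q hq).le) hc (hKcl hx)
  have hK2 : ∀ x ∈ K, h (x - (v + e)) ≤ 0 := by
    intro x hx
    have hc : IsClosed {x | h (x - (v + e)) ≤ 0} := isClosed_le (by fun_prop) continuous_const
    exact closure_minimal (fun q hq => hle q hq) hc (hKcl hx)
  have hTv : ∀ z, GT K v z → 0 ≤ h z := by
    rintro z ⟨t, ht, htz⟩
    have := hK1 _ htz
    rw [add_sub_cancel_left, map_smul, smul_eq_mul] at this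
    exact nonneg_of_mul_nonneg_right this ht
  have hTw : ∀ z, GT K (v + e) z → h z ≤ 0 := by
    rintro z ⟨t, ht, htz⟩
    have := hK2 _ htz
    rw [add_sub_cancel_left, map_smul, smul_eq_mul] at this
    by_contra hc
    push Not at hc
    have := mul_pos ht hc
    linarith
  have hTp : ∀ z, GT K v z → ∀ c : ℝ, GT K p (z + c • e) := by
    rintro z ⟨t, ht, htz⟩ c
    have ev1 : ∀ᶠ τ : ℝ in nhdsWithin 0 (Ioi 0), 0 < τ := self_mem_nhdsWithin
    have ev2 : ∀ᶠ τ : ℝ in nhdsWithin 0 (Ioi 0), 0 < lam i + τ * c := by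
      refine Filter.Eventually.filter_mono nhdsWithin_le_nhds ?_
      exact (by fun_prop : Continuous fun τ : ℝ => lam i + τ * c).continuousAt.eventually_mem
        (isOpen_Ioi.mem_nhds (by simpa using hli0))
    have ev3 : ∀ᶠ τ : ℝ in nhdsWithin 0 (Ioi 0), τ / t + (lam i + τ * c) < 1 := by
      refine Filter.Eventually.filter_mono nhdsWithin_le_nhds ?_
      exact (by fun_prop : Continuous fun τ : ℝ => τ / t + (lam i + τ * c)).continuousAt.eventually_mem
        (isOpen_Iio.mem_nhds (by simpa using hli1))
    obtain ⟨τ, h1, h2, h3⟩ := (ev1.and (ev2.and ev3)).exists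
    refine ⟨τ, h1, ?_⟩
    have hd : 0 < τ / t := div_pos h1 ht
    have hτ : 0 < τ / t + (lam i + τ * c) := by linarith
    have hy : ((τ / t) / (τ / t + (lam i + τ * c))) • (v + t • z) +
        ((lam i + τ * c) / (τ / t + (lam i + τ * c))) • (v + e) ∈ K :=
      hT.conv htz hw (by positivity) (by positivity) (by field_simp)
    have := hT.conv.add_smul_sub_mem hvK hy (t := τ / t + (lam i + τ * c)) ⟨hτ.le, h3.le⟩
    have key : ∀ (σ x y : ℝ) (A B : E), σ ≠ 0 →
        σ • ((x / σ) • A + (y / σ) • B - v) = x • A + y • B - σ • v := by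
      intro σ x y A B hσ
      match_scalars <;> field_simp
    rw [key _ _ _ _ _ hτ.ne'] at this
    convert this using 1
    rw [hp]
    match_scalars <;> field_simp <;> ring
  refine ⟨(h e)⁻¹ • h, ?_, ?_, ?_⟩
  · simp [hhe.ne']
  · intro x hx
    simp only [smul_apply, smul_eq_mul]
    refine ⟨mul_nonneg (inv_nonneg.2 hhe.le) (hK1 x hx), ?_⟩
    have h2 := hK2 x hx
    have : h (x - (v + e)) = h (x - v) - h e := by simp; ring
    rw [inv_mul_le_one₀ hhe]
    linarith
  · intro z hz δ hδ
    simp only [smul_apply, smul_eq_mul]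
    constructor
    · have h1 := hTp z hz (-((h e)⁻¹ * h z - δ))
      rw [neg_smul, ← sub_eq_add_neg] at h1
      rcases claim1' _ h1 with h2 | h2
      · exact h2
      · exfalso
        have h3 := hTw _ h2
        have : h (z - ((h e)⁻¹ * h z - δ) • e) = δ * h e := by
          simp only [map_sub, map_smul, smul_eq_mul]; field_simp; ring
        have := mul_pos hδ hhe
        linarith
    · have h1 := hTp z hz (-((h e)⁻¹ * h z + δ))
      rw [neg_smul, ← sub_eq_add_neg] at h1
      rcases claim1' _ h1 with h2 | h2
      · exfalso
        have h3 := hTv _ h2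
        have : h (z - ((h e)⁻¹ * h z + δ) • e) = - (δ * h e) := by
          simp only [map_sub, map_smul, smul_eq_mul]; field_simp; ring
        have := mul_pos hδ hhe
        linarith
      · exact h2

theorem GTiling.edge (hT : GTiling K n a lam) {v r : E} (hv : v ∈ K.exposedPoints ℝ)
    (hr : r ≠ 0) (φ : E →L[ℝ] ℝ) (hφr : φ r = 0)
    (hφ : ∀ x ∈ K, φ x ≤ φ v)
    (hface : ∀ x ∈ K, φ x = φ v → ∃ t : ℝ, 0 ≤ t ∧ x = v + t • r) (hGT : GT K v r) :
    ∃ L : ℝ, 0 < L ∧ v + L • r ∈ K ∧ ∃ h : E →L[ℝ] ℝ, h (L • r) = 1 ∧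
      (∀ x ∈ K, 0 ≤ h (x - v) ∧ h (x - v) ≤ 1) ∧
      ∀ z, GT K v z → ∀ δ : ℝ, 0 < δ →
        GT K v (z - (h z - δ) • (L • r)) ∧ GT K (v + L • r) (z - (h z + δ) • (L • r)) := by
  have hc : IsCompact (K ∩ {x | φ x = φ v}) :=
    hT.comp.inter_right (isClosed_eq (by fun_prop) (by fun_prop))
  obtain ⟨x, hx, hmax⟩ := hc.exists_isMaxOn ⟨v, hv.1, rfl⟩ (f := fun x => ‖x - v‖)
    (by fun_prop)
  obtain ⟨L, hL0, hL⟩ := hface x hx.1 hx.2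
  have hrn : 0 < ‖r‖ := norm_pos_iff.2 hr
  have hle : ∀ t : ℝ, 0 ≤ t → v + t • r ∈ K → t ≤ L := by
    intro t ht htK
    have h1 := hmax (show v + t • r ∈ K ∩ {x | φ x = φ v} from ⟨htK, by simp [hφr]⟩)
    simp only [mem_ofPred_eq, hL, add_sub_cancel_left, norm_smul, Real.norm_eq_abs,
      abs_of_nonneg ht, abs_of_nonneg hL0] at h1
    exact le_of_mul_le_mul_right h1 hrn
  obtain ⟨τ, hτ, hτK⟩ := hGT
  have hLpos : 0 < L := lt_of_lt_of_le hτ (hle τ hτ.le hτK)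
  have hLK : v + L • r ∈ K := hL ▸ hx.1
  refine ⟨L, hLpos, hLK, hT.edge_core hv (smul_ne_zero hLpos.ne' hr) hLK φ (by simp [hφr]) hφ ?_⟩
  intro y hy hyφ
  obtain ⟨t, ht0, ht⟩ := hface y hy hyφ
  have := hle t ht0 (ht ▸ hy)
  refine ⟨t / L, by positivity, (div_le_one hLpos).2 this, ?_⟩
  rw [ht, smul_smul, div_mul_cancel₀ _ hLpos.ne']

/-- Finite form of Straszewicz' theorem. -/
theorem subset_convexHull_exposed {d : ℕ} {K : Set (Fin d → ℝ)} (hK : IsCompact K)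
    (hfin : (K.exposedPoints ℝ).Finite) : K ⊆ convexHull ℝ (K.exposedPoints ℝ) := by
  intro z hz
  by_contra hzQ
  obtain ⟨l, c, hl1, hl2⟩ := geometric_hahn_banach_closed_point (convex_convexHull ℝ _)
    (hfin.isClosed_convexHull (𝕜 := ℝ)) hzQ
  have hcont : Continuous fun y : Fin d → ℝ => y ⬝ᵥ y := by fun_prop
  obtain ⟨m, hm, hmmax⟩ := hK.exists_isMaxOn ⟨z, hz⟩ hcont.continuousOn
  obtain ⟨R, hR⟩ : ∃ R, R = (m ⬝ᵥ m + 1) / (l z - c) := ⟨_, rfl⟩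
  have hnn : ∀ y : Fin d → ℝ, 0 ≤ y ⬝ᵥ y := fun y => Finset.sum_nonneg fun i _ => mul_self_nonneg (y i)
  have hd : 0 < l z - c := by linarith
  have hR0 : 0 < R := by rw [hR]; have := hnn m; positivity
  have hRd : R * (l z - c) = m ⬝ᵥ m + 1 := by rw [hR]; field_simp
  obtain ⟨p, hp, hpmax⟩ := hK.exists_isMaxOn ⟨z, hz⟩
    (f := fun y : Fin d → ℝ => y ⬝ᵥ y + R * l y) (by fun_prop)
  have hpexp : p ∈ K.exposedPoints ℝ := by
    let g : (Fin d → ℝ) →L[ℝ] ℝ :=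
      LinearMap.toContinuousLinearMap (dotProductBilin ℝ ℝ p)
    refine ⟨hp, (2 : ℝ) • g + R • l, fun y hy => ?_⟩
    have h1 : y ⬝ᵥ y + R * l y ≤ p ⬝ᵥ p + R * l p := hpmax hy
    have h2 : ∀ y, ((2 : ℝ) • g + R • l) y = 2 * (p ⬝ᵥ y) + R * l y := fun y => by
      simp [g]
    have h3 : (y - p) ⬝ᵥ (y - p) = y ⬝ᵥ y - 2 * (p ⬝ᵥ y) + p ⬝ᵥ p := by
      simp only [sub_dotProduct, dotProduct_sub, dotProduct_comm y p]; ring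
    have h4 := hnn (y - p)
    rw [h2, h2]
    refine ⟨by linarith, fun h5 => ?_⟩
    have : (y - p) ⬝ᵥ (y - p) = 0 := by linarith
    exact sub_eq_zero.1 (dotProduct_self_eq_zero.1 this)
  have h1 := hl1 p (subset_convexHull ℝ _ hpexp)
  have h2 : z ⬝ᵥ z + R * l z ≤ p ⬝ᵥ p + R * l p := hpmax hz
  have h3 : p ⬝ᵥ p ≤ m ⬝ᵥ m := hmmax hp
  have h4 := hnn z
  have h5 := mul_lt_mul_of_pos_left h1 hR0
  nlinarith

/-- `K` is contained in the cone at `v` over the section `S`. -/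
theorem cone_aux {v : E} {S V : Set E} (hS : Convex ℝ S)
    (hV : ∀ w ∈ V, w = v ∨ ∃ τ : ℝ, 0 < τ ∧ ∃ s ∈ S, w = v + τ • s) :
    ∀ x ∈ convexHull ℝ V, x = v ∨ ∃ τ : ℝ, 0 < τ ∧ ∃ s ∈ S, x = v + τ • s := by
  have hc : Convex ℝ {x : E | x = v ∨ ∃ τ : ℝ, 0 < τ ∧ ∃ s ∈ S, x = v + τ • s} := by
    rw [convex_iff_forall_pos]
    rintro x (rfl | ⟨τ, hτ, s, hs, rfl⟩) y (rfl | ⟨τ', hτ', s', hs', rfl⟩) α β hα hβ hαβ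
    · left; rw [← add_smul, hαβ, one_smul]
    · right
      refine ⟨β * τ', by positivity, s', hs', ?_⟩
      have : α = 1 - β := by linarith
      subst this; module
    · right
      refine ⟨α * τ, by positivity, s, hs, ?_⟩
      have : α = 1 - β := by linarith
      subst this; module
    · right
      have h1 := mul_pos hα hτ
      have h2 := mul_pos hβ hτ'
      refine ⟨α * τ + β * τ', by positivity, (α * τ / (α * τ + β * τ')) • s +
        (β * τ' / (α * τ + β * τ')) • s', ?_, ?_⟩
      · exact hS hs hs' (by positivity) (by positivity) (by field_simp)
      · have h3 : (α * τ + β * τ') ≠ 0 := by positivity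
        have : α = 1 - β := by linarith
        have key : ∀ (σ x y : ℝ) (A B : E), σ ≠ 0 →
            σ • ((x / σ) • A + (y / σ) • B) = x • A + y • B := by
          intro σ x y A B hσ
          match_scalars <;> field_simp
        rw [key _ _ _ _ _ h3]
        subst this; module
  exact fun x hx => convexHull_min hV hc hx

/-- Every vertex is the corner of a box with respect to some basis. -/
theorem GTiling.corner {d : ℕ} {K : Set (Fin d → ℝ)} {a : Fin n → Fin d → ℝ}
    (hT : GTiling K n a lam) {v : Fin d → ℝ} (hv : v ∈ K.exposedPoints ℝ) :
    ∃ b : Module.Basis (Fin d) ℝ (Fin d → ℝ), (∀ i, v + b i ∈ K) ∧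
      ∀ x ∈ K, ∀ i, 0 ≤ b.coord i (x - v) ∧ b.coord i (x - v) ≤ 1 := by
  classical
  have hfin := hT.finite_exposed
  have hKV := subset_convexHull_exposed hT.comp hfin
  have hvK := hv.1
  obtain ⟨-, u, hu⟩ := id hv
  obtain ⟨s, hs⟩ : ∃ s : (Fin d → ℝ) → (Fin d → ℝ), s = fun w => (u v - u w)⁻¹ • (w - v) :=
    ⟨_, rfl⟩
  obtain ⟨S, hS⟩ : ∃ S, S = convexHull ℝ (s '' (K.exposedPoints ℝ \ {v})) := ⟨_, rfl⟩
  have hfin' : (s '' (K.exposedPoints ℝ \ {v})).Finite := (hfin.subset sdiff_subset).image _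
  have hlt : ∀ w ∈ K, w ≠ v → 0 < u v - u w := by
    intro w hw hne
    by_contra hc
    exact hne ((hu w hw).2 (by linarith))
  have hws : ∀ w ∈ K, w ≠ v → w = v + (u v - u w) • s w := by
    intro w hw hne
    rw [hs]
    simp only
    rw [smul_smul, mul_inv_cancel₀ (hlt w hw hne).ne']; simp
  have hScomp : IsCompact S := by rw [hS]; exact hfin'.isCompact_convexHull ℝ
  have hXsub : S.exposedPoints ℝ ⊆ s '' (K.exposedPoints ℝ \ {v}) := by
    refine exposedPoints_subset_extremePoints.trans ?_
    rw [hS]; exact extremePoints_convexHull_subset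
  have hXfin : (S.exposedPoints ℝ).Finite := hfin'.subset hXsub
  have hSX := subset_convexHull_exposed hScomp hXfin
  have huS : ∀ x ∈ S, u x = -1 := by
    have : S ⊆ {x | u x = -1} := by
      rw [hS]
      refine convexHull_min ?_ (convex_hyperplane u.isLinear _)
      rintro _ ⟨w, hw, rfl⟩
      have := (hlt w hw.1.1 hw.2).ne'
      show u (s w) = -1
      rw [hs]
      simp only [map_smul, map_sub, smul_eq_mul]
      field_simp; ring
    exact this
  have hcone : ∀ x ∈ K, x = v ∨ ∃ τ : ℝ, 0 < τ ∧ ∃ y ∈ S, x = v + τ • y := by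
    intro x hx
    refine cone_aux (S := S) (by rw [hS]; exact convex_convexHull ℝ _) ?_ x (hKV hx)
    intro w hw
    by_cases hne : w = v
    · exact Or.inl hne
    · right
      exact ⟨_, hlt w hw.1 hne, s w, by rw [hS]; exact subset_convexHull ℝ _ ⟨w, ⟨hw, hne⟩, rfl⟩,
        hws w hw.1 hne⟩
  -- the functional exposing a ray
  have hray : ∀ r : S.exposedPoints ℝ, ∃ φ : (Fin d → ℝ) →L[ℝ] ℝ, φ r = 0 ∧
      (∀ y ∈ S, y ≠ r → φ y < 0) ∧ GT K v r := by
    rintro ⟨r, hr⟩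
    obtain ⟨hrS, g, hg⟩ := id hr
    refine ⟨g + g r • u, ?_, ?_, ?_⟩
    · simp [huS r hrS]
    · intro y hy hne
      have : g y < g r := by
        by_contra hc
        exact hne ((hg y hy).2 (by linarith))
      simp [huS y hy, this]
    · obtain ⟨w, hw, rfl⟩ := hXsub hr
      refine ⟨_, hlt w hw.1.1 hw.2, ?_⟩
      rw [← hws w hw.1.1 hw.2]; exact hw.1.1
  choose φ hφ0 hφneg hGT using hray
  have hr0 : ∀ r : S.exposedPoints ℝ, (r : Fin d → ℝ) ≠ 0 := by
    intro r h
    have := huS r r.2.1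
    rw [h] at this; simp at this
  have hφle : ∀ r : S.exposedPoints ℝ, ∀ x ∈ K, φ r x ≤ φ r v := by
    intro r x hx
    rcases hcone x hx with rfl | ⟨τ, hτ, y, hy, rfl⟩
    · exact le_rfl
    · have : φ r y ≤ 0 := by
        by_cases h : y = r
        · rw [h, hφ0]
        · exact (hφneg r y hy h).le
      simp only [map_add, map_smul, smul_eq_mul]
      nlinarith
  have hedge := fun r : S.exposedPoints ℝ => hT.edge hv (hr0 r) (φ r) (hφ0 r) (hφle r) (by
    intro x hx hxφ
    rcases hcone x hx with rfl | ⟨τ, hτ, y, hy, rfl⟩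
    · exact ⟨0, le_rfl, by simp⟩
    · refine ⟨τ, hτ.le, ?_⟩
      by_cases h : y = r
      · rw [h]
      · have := hφneg r y hy h
        simp only [map_add, map_smul, smul_eq_mul] at hxφ
        nlinarith) (hGT r)
  choose L hL0 hLK h hh1 hhK hhT using hedge
  have hdual : ∀ r r' : S.exposedPoints ℝ, r ≠ r' → h r (r' : Fin d → ℝ) = 0 := by
    intro r r' hne
    have hnn : 0 ≤ h r (r' : Fin d → ℝ) := by
      obtain ⟨t, ht, htK⟩ := hGT r'
      have := (hhK r _ htK).1
      rw [add_sub_cancel_left, map_smul, smul_eq_mul] at this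
      exact nonneg_of_mul_nonneg_right this ht
    by_contra hc
    have hpos : 0 < h r (r' : Fin d → ℝ) := lt_of_le_of_ne hnn (Ne.symm hc)
    obtain ⟨t, ht, htK⟩ := (hhT r r' (hGT r') (h r (r' : Fin d → ℝ) / 2) (by positivity)).1
    have h1 := hφle r' _ htK
    have h2 := hφneg r' r r.2.1 (fun h => hne (Subtype.ext h))
    simp only [map_add, map_smul, map_sub, smul_eq_mul, hφ0] at h1
    have h3 := hL0 r
    have : 0 < t * (h r (r' : Fin d → ℝ) / 2 * (L r * -(φ r' r))) := by
      have : 0 < -(φ r' r) := by linarith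
      positivity
    nlinarith
  have : Finite (S.exposedPoints ℝ) := hXfin
  have := Fintype.ofFinite (S.exposedPoints ℝ)
  obtain ⟨f, hf⟩ : ∃ f : S.exposedPoints ℝ → (Fin d → ℝ), f = fun r => L r • (r : Fin d → ℝ) :=
    ⟨_, rfl⟩
  have hfdual : ∀ r r', h r (f r') = if r = r' then 1 else 0 := by
    intro r r'
    split_ifs with heq
    · rw [← heq, hf]; exact hh1 r
    · rw [hf]; simp [hdual r r' heq]
  have hli : LinearIndependent ℝ f := by
    rw [Fintype.linearIndependent_iff]
    intro g hg r
    have := congrArg (h r) hg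
    simpa [hfdual] using this
  have hspan : ⊤ ≤ Submodule.span ℝ (range f) := by
    have h1 : ∀ r : S.exposedPoints ℝ, (r : Fin d → ℝ) ∈ Submodule.span ℝ (range f) := by
      intro r
      have h2 : f r ∈ Submodule.span ℝ (range f) := Submodule.subset_span ⟨r, rfl⟩
      have h3 := Submodule.smul_mem _ (L r)⁻¹ h2
      rw [hf] at h3 ⊢
      simp only at h3
      rwa [smul_smul, inv_mul_cancel₀ (hL0 r).ne', one_smul] at h3
    have h2 : S ⊆ Submodule.span ℝ (range f) :=
      hSX.trans (convexHull_min (fun r hr => h1 ⟨r, hr⟩) (Submodule.convex _))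
    have h3 : ∀ x ∈ K, x - v ∈ Submodule.span ℝ (range f) := by
      intro x hx
      rcases hcone x hx with rfl | ⟨τ, hτ, y, hy, rfl⟩
      · simp
      · rw [add_sub_cancel_left]; exact Submodule.smul_mem _ _ (h2 hy)
    intro z _
    obtain ⟨q, hq⟩ := hT.int
    have hc : Continuous fun t : ℝ => q + t • z := by fun_prop
    have ev : ∀ᶠ t : ℝ in nhdsWithin 0 (Ioi 0), q + t • z ∈ interior K :=
      Filter.Eventually.filter_mono nhdsWithin_le_nhds
        (hc.continuousAt.eventually_mem (isOpen_interior.mem_nhds (by simpa using hq)))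
    have ev1 : ∀ᶠ t : ℝ in nhdsWithin 0 (Ioi 0), 0 < t := self_mem_nhdsWithin
    obtain ⟨t, ht, ht0⟩ := (ev.and ev1).exists
    have h4 := Submodule.smul_mem _ t⁻¹ (Submodule.sub_mem _ (h3 _ (interior_subset ht))
      (h3 _ (interior_subset hq)))
    have h5 : t⁻¹ • (q + t • z - v - (q - v)) = z := by
      have : q + t • z - v - (q - v) = t • z := by abel
      rw [this, smul_smul, inv_mul_cancel₀ ht0.ne', one_smul]
    rwa [h5] at h4
  let B := Module.Basis.mk hli hspan
  have hB : ∀ r, B r = f r := fun r => Module.Basis.mk_apply hli hspan r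
  have hBc : ∀ r, B.coord r = (h r : (Fin d → ℝ) →ₗ[ℝ] ℝ) := by
    intro r
    refine B.ext fun r' => ?_
    rw [Module.Basis.coord_apply, Module.Basis.repr_self, hB]
    simp only [ContinuousLinearMap.coe_coe, hfdual, Finsupp.single_apply]
    simp only [eq_comm]
  have hcard : Fintype.card (S.exposedPoints ℝ) = d := by
    rw [← Module.finrank_eq_card_basis B]; simp
  let eq := Fintype.equivFinOfCardEq hcard
  refine ⟨B.reindex eq, ?_, ?_⟩
  · intro i
    rw [Module.Basis.reindex_apply, hB, hf]
    exact hLK _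
  · intro x hx i
    have : (B.reindex eq).coord i (x - v) = h (eq.symm i) (x - v) := by
      rw [Module.Basis.coord_apply, Module.Basis.repr_reindex_apply, ← Module.Basis.coord_apply,
        hBc]; rfl
    rw [this]
    exact hhK _ x hx

theorem GT.add (hK : Convex ℝ K) {v x y : E} (hx : GT K v x) (hy : GT K v y) :
    GT K v (x + y) := by
  obtain ⟨t, ht, htK⟩ := hx
  obtain ⟨s, hs, hsK⟩ := hy
  refine ⟨t * s / (t + s), by positivity, ?_⟩
  have := hK htK hsK (a := s / (t + s)) (b := t / (t + s)) (by positivity) (by positivity)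
    (by field_simp; ring)
  convert this using 1
  match_scalars <;> field_simp <;> ring

theorem GT.smul_nonneg {v x : E} (hv : v ∈ K) (hx : GT K v x) {c : ℝ} (hc : 0 ≤ c) :
    GT K v (c • x) := by
  obtain ⟨t, ht, htK⟩ := hx
  rcases hc.eq_or_lt with rfl | hc
  · exact ⟨1, one_pos, by simpa using hv⟩
  · refine ⟨t / c, by positivity, ?_⟩
    rwa [smul_smul, div_mul_cancel₀ _ hc.ne']

theorem GT.of_coord {d : ℕ} {K : Set (Fin d → ℝ)} (hK : Convex ℝ K) {v : Fin d → ℝ} (hv : v ∈ K)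
    (b : Module.Basis (Fin d) ℝ (Fin d → ℝ)) (hb : ∀ i, v + b i ∈ K) {z : Fin d → ℝ}
    (hz : ∀ i, 0 ≤ b.coord i z) : GT K v z := by
  rw [← b.sum_repr z]
  refine Finset.sum_induction _ (GT K v) (fun _ _ => GT.add hK) ⟨1, one_pos, by simpa using hv⟩ ?_
  intro i _
  exact GT.smul_nonneg hv ⟨1, one_pos, by simpa using hb i⟩ (hz i)

/-- The sign attached to coordinate `k` at the box vertex indexed by `S`. -/
noncomputable def gsgn {d : ℕ} (S : Finset (Fin d)) (k : Fin d) : ℝ := if k ∈ S then -1 else 1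

theorem GTiling.box {d : ℕ} {K : Set (Fin d → ℝ)} {a : Fin n → Fin d → ℝ}
    (hT : GTiling K n a lam) {v : Fin d → ℝ}
    (b : Module.Basis (Fin d) ℝ (Fin d → ℝ)) (hvK : v ∈ K) (hb : ∀ i, v + b i ∈ K)
    (hbox : ∀ x ∈ K, ∀ i, 0 ≤ b.coord i (x - v) ∧ b.coord i (x - v) ≤ 1) (S : Finset (Fin d)) :
    v + ∑ i ∈ S, b i ∈ K ∧ ∀ k, GT K (v + ∑ i ∈ S, b i) (gsgn S k • b k) := by
  classical
  have hcb : ∀ i k, b.coord i (b k) = if i = k then 1 else 0 := by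
    intro i k
    rw [Module.Basis.coord_apply, Module.Basis.repr_self, Finsupp.single_apply]
    simp only [eq_comm]
  have hcS : ∀ (S : Finset (Fin d)) i, b.coord i (∑ k ∈ S, b k) = if i ∈ S then 1 else 0 := by
    intro S i
    simp [hcb, -Module.Basis.coord_apply]
  -- exposing functionals of faces
  have hψ : ∀ (S J : Finset (Fin d)), ∃ ψ : (Fin d → ℝ) →L[ℝ] ℝ,
      (∀ k ∉ J, ψ (b k) = 0) ∧ ∀ x ∈ K, ψ x ≤ ψ (v + ∑ i ∈ S, b i) ∧
        (ψ (v + ∑ i ∈ S, b i) ≤ ψ x →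
          ∀ k ∈ J, b.coord k (x - (v + ∑ i ∈ S, b i)) = 0) := by
    intro S J
    refine ⟨LinearMap.toContinuousLinearMap (∑ k ∈ J, (-gsgn S k) • b.coord k), ?_, ?_⟩
    · intro k hk
      simp only [LinearMap.coe_toContinuousLinearMap', LinearMap.sum_apply, LinearMap.smul_apply,
        smul_eq_mul, hcb]
      refine Finset.sum_eq_zero fun i hi => ?_
      rw [if_neg (by rintro rfl; exact hk hi), mul_zero]
    · intro x hx
      have h1 : ∀ k, -gsgn S k * b.coord k x ≤ -gsgn S k * b.coord k (v + ∑ i ∈ S, b i) := by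
        intro k
        have h2 := hbox x hx k
        rw [map_sub] at h2
        rw [map_add, hcS, gsgn]
        split_ifs <;> linarith
      have h2 : ∀ x, LinearMap.toContinuousLinearMap (∑ k ∈ J, (-gsgn S k) • b.coord k) x =
          ∑ k ∈ J, -gsgn S k * b.coord k x := by
        intro x
        simp only [LinearMap.coe_toContinuousLinearMap', LinearMap.sum_apply,
          LinearMap.smul_apply, smul_eq_mul]
      rw [h2, h2]
      have h3 : ∑ k ∈ J, -gsgn S k * b.coord k x ≤
          ∑ k ∈ J, -gsgn S k * b.coord k (v + ∑ i ∈ S, b i) :=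
        Finset.sum_le_sum fun k _ => h1 k
      refine ⟨h3, fun h4 k hk => ?_⟩
      have h5 := (Finset.sum_eq_sum_iff_of_le fun k _ => h1 k).1 (le_antisymm h3 h4) k hk
      have h6 : -gsgn S k ≠ 0 := by rw [gsgn]; split_ifs <;> norm_num
      rw [map_sub, sub_eq_zero]
      exact mul_left_cancel₀ h6 h5
  have hexp : ∀ S : Finset (Fin d), v + ∑ i ∈ S, b i ∈ K →
      v + ∑ i ∈ S, b i ∈ K.exposedPoints ℝ := by
    intro S hS
    obtain ⟨ψ, -, h⟩ := hψ S Finset.univ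
    refine ⟨hS, ψ, fun x hx => ⟨(h x hx).1, fun h1 => ?_⟩⟩
    have h2 := (h x hx).2 h1
    rw [← sub_eq_zero]
    refine b.ext_elem fun k => ?_
    rw [← Module.Basis.coord_apply, h2 k (Finset.mem_univ k)]; simp
  induction S using Finset.induction_on with
  | empty =>
    simp only [Finset.sum_empty, add_zero]
    refine ⟨hvK, fun k => ⟨1, one_pos, ?_⟩⟩
    simpa [gsgn] using hb k
  | insert j S hj ih =>
    obtain ⟨hpK, hpT⟩ := ih
    obtain ⟨ψ, hψ0, hψ1⟩ := hψ S (Finset.univ.erase j)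
    obtain ⟨p, hp⟩ : ∃ p, p = v + ∑ i ∈ S, b i := ⟨_, rfl⟩
    have hpe := hexp S hpK
    rw [← hp] at hpe hpK hpT hψ1
    have hpj : ∀ z, b.coord j (p + z - v) = b.coord j z := by
      intro z
      have : p + z - v = ∑ i ∈ S, b i + z := by rw [hp]; abel
      rw [this, map_add, hcS, if_neg hj, zero_add]
    have hTj : ∀ z, GT K p z → 0 ≤ b.coord j z := by
      rintro z ⟨t, ht, htK⟩
      have := (hbox _ htK j).1
      rw [hpj, map_smul, smul_eq_mul] at this
      exact nonneg_of_mul_nonneg_right this ht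
    obtain ⟨L, hL0, hLK, h, hh1, hhK, hhT⟩ := hT.edge hpe (b.ne_zero j) ψ
      (hψ0 j (by simp)) (fun x hx => (hψ1 x hx).1) (by
        intro x hx hxψ
        have h1 := (hψ1 x hx).2 hxψ.ge
        refine ⟨b.coord j (x - p), ?_, ?_⟩
        · have := (hbox x hx j).1
          have h2 := hpj (x - p)
          rw [add_sub_cancel] at h2
          rwa [← h2]
        · rw [← sub_eq_iff_eq_add']
          refine b.ext_elem fun k => ?_
          rw [← Module.Basis.coord_apply, ← Module.Basis.coord_apply]
          rw [map_smul, hcb, smul_eq_mul]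
          split_ifs with hkj
          · rw [hkj, mul_one]
          · rw [mul_zero]; exact h1 k (by simp [hkj]))
      (by simpa [gsgn, hj] using hpT j)
    have hhz : ∀ k, k ≠ j → h (gsgn S k • b k) = 0 := by
      intro k hk
      have hnn : 0 ≤ h (gsgn S k • b k) := by
        obtain ⟨t, ht, htK⟩ := hpT k
        have := (hhK _ htK).1
        rw [add_sub_cancel_left, map_smul, smul_eq_mul] at this
        exact nonneg_of_mul_nonneg_right this ht
      by_contra hc
      have hpos : 0 < h (gsgn S k • b k) := lt_of_le_of_ne hnn (Ne.symm hc)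
      have h1 := hTj _ (hhT _ (hpT k) (h (gsgn S k • b k) / 2) (by positivity)).1
      rw [map_sub, map_smul (b.coord j) _ (b k), map_smul (b.coord j), map_smul (b.coord j), hcb,
        hcb, if_neg (Ne.symm hk), if_pos rfl] at h1
      simp only [smul_eq_mul, mul_zero, mul_one] at h1
      have := mul_pos hpos hL0
      nlinarith
    have hhb : ∀ k, k ≠ j → h (b k) = 0 := by
      intro k hk
      have := hhz k hk
      rw [map_smul, smul_eq_mul] at this
      refine (mul_eq_zero.1 this).resolve_left ?_
      rw [gsgn]; split_ifs <;> norm_num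
    rw [map_smul, smul_eq_mul] at hh1
    have hL1 : L = 1 := by
      apply le_antisymm
      · have := (hbox _ hLK j).2
        rw [hpj, map_smul, hcb, if_pos rfl, smul_eq_mul, mul_one] at this
        exact this
      · have h1 := (hhK _ (hb j)).2
        have h2 : h (v + b j - p) = h (b j) := by
          have : v + b j - p = b j - ∑ i ∈ S, b i := by rw [hp]; abel
          rw [this, map_sub, map_sum, Finset.sum_eq_zero, sub_zero]
          intro i hi
          exact hhb i (by rintro rfl; exact hj hi)
        rw [h2] at h1
        nlinarith
    subst hL1
    have hw : v + ∑ i ∈ insert j S, b i = p + (1 : ℝ) • b j := by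
      rw [Finset.sum_insert hj, hp]; module
    have hwe := hexp (insert j S) (by rw [hw]; exact hLK)
    rw [hw] at hwe ⊢
    refine ⟨hLK, fun k => ?_⟩
    by_cases hk : k = j
    · subst hk
      refine ⟨1, one_pos, ?_⟩
      have : p + (1 : ℝ) • b k + (1 : ℝ) • (gsgn (insert k S) k • b k) = p := by
        rw [gsgn, if_pos (Finset.mem_insert_self _ _)]; module
      rw [this]; exact hpK
    · have hs : gsgn (insert j S) k = gsgn S k := by simp [gsgn, hk]
      rw [hs]
      obtain ⟨b', hb'1, hb'2⟩ := hT.corner hwe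
      refine GT.of_coord hT.conv hLK b' hb'1 fun i => ?_
      obtain ⟨X, hX⟩ : ∃ X, X = b'.coord i (gsgn S k • b k) := ⟨_, rfl⟩
      obtain ⟨Y, hY⟩ : ∃ Y, Y = b'.coord i (b j) := ⟨_, rfl⟩
      have key : ∀ δ : ℝ, 0 < δ → 0 ≤ X - δ * Y := by
        intro δ hδ
        obtain ⟨t, ht, htK⟩ := (hhT _ (hpT k) δ hδ).2
        have := (hb'2 _ htK i).1
        rw [add_sub_cancel_left, map_smul, smul_eq_mul, hhz k hk, zero_add, one_smul, map_sub,
          map_smul (b'.coord i) δ, smul_eq_mul, ← hX, ← hY] at this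
        exact nonneg_of_mul_nonneg_right this ht
      rw [← hX]
      by_contra hc
      push Not at hc
      have h1 := key (-X / (2 * (|Y| + 1))) (by apply div_pos; linarith; positivity)
      have h2 : -X / (2 * (|Y| + 1)) * (|Y| + 1) = -X / 2 := by field_simp
      have h3 : 0 < -X / (2 * (|Y| + 1)) := by apply div_pos; linarith; positivity
      have h4 := neg_abs_le Y
      nlinarith

end groemer

/-- Groemer's theorem: a `d`-dimensional compact convex set that is the union of
    at least two homothetic copies of itself with pairwise disjoint interiors is a
    parallelepiped. -/
theorem groemer_parallelepiped {d : ℕ} (K : Set (Fin d → ℝ))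
    (hcomp : IsCompact K) (hconv : Convex ℝ K) (hdim : affineSpan ℝ K = ⊤)
    (n : ℕ) (hn : 2 ≤ n) (a : Fin n → Fin d → ℝ) (lam : Fin n → ℝ)
    (hlam : ∀ i, 0 < lam i)
    (hcover : K = ⋃ i, (fun p => a i + lam i • p) '' K)
    (hdisj : ∀ i j, i ≠ j →
      Disjoint (interior ((fun p => a i + lam i • p) '' K))
        (interior ((fun p => a j + lam j • p) '' K))) :
    IsParallelepiped K := by
  classical
  have hmem : ∀ i, ∀ x ∈ K, a i + lam i • x ∈ K := by
    intro i x hx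
    rw [hcover]
    exact mem_iUnion.2 ⟨i, x, hx, rfl⟩
  have himg : ∀ i, ∀ x ∈ interior K, a i + lam i • x ∈
      interior ((fun p => a i + lam i • p) '' K) := by
    intro i x hx
    have ho : IsOpenMap (fun p : Fin d → ℝ => a i + lam i • p) :=
      (isOpenMap_add_left (a i)).comp (isOpenMap_smul₀ (hlam i).ne')
    exact ho.image_interior_subset K ⟨x, hx, rfl⟩
  have hT : GTiling K n a lam :=
    { comp := hcomp
      conv := hconv
      int := hconv.interior_nonempty_iff_affineSpan_eq_top.2 hdim
      pos := hlam
      mem := hmem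
      memint := fun i x hx => interior_mono (by rintro _ ⟨y, hy, rfl⟩; exact hmem i y hy)
        (himg i x hx)
      cov := by
        intro x hx
        rw [hcover] at hx
        obtain ⟨i, y, hy, h⟩ := mem_iUnion.1 hx
        exact ⟨i, y, hy, h.symm⟩
      disj := by
        intro i j hij x hx y hy h
        exact Set.disjoint_left.1 (hdisj i j hij) (himg i x hx) (h ▸ himg j y hy)
      two := by
        intro i
        have : Nontrivial (Fin n) := Fin.nontrivial_iff_two_le.2 hn
        exact exists_ne i }
  obtain ⟨q, hq⟩ := hT.int
  obtain ⟨v, hv⟩ : (K.exposedPoints ℝ).Nonempty := by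
    rw [← convexHull_nonempty_iff (𝕜 := ℝ)]
    exact ⟨q, subset_convexHull_exposed hcomp hT.finite_exposed (interior_subset hq)⟩
  obtain ⟨b, hb, hbox⟩ := hT.corner hv
  have hS := fun S => (hT.box b hv.1 hb hbox S).1
  refine ⟨v + ∑ i, (1 / 2 : ℝ) • b i, fun i => (1 / 2 : ℝ) • b i, ?_, ?_⟩
  · have := b.linearIndependent.units_smul (fun _ => Units.mk0 (1 / 2 : ℝ) (by norm_num))
    exact this
  · apply Subset.antisymm
    · intro x hx
      have h1 : x - v ∈ parallelepiped b := by
        rw [parallelepiped_basis_eq]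
        intro i
        exact hbox x hx i
      have h2 : parallelepiped b ⊆ (fun z => z + v) ⁻¹' (convexHull ℝ
          {p : Fin d → ℝ | ∃ ε : Fin d → ℝ, (∀ i, ε i = 1 ∨ ε i = -1) ∧
            p = v + ∑ i, (1 / 2 : ℝ) • b i + ∑ i, ε i • (1 / 2 : ℝ) • b i}) := by
        rw [parallelepiped_eq_convexHull]
        refine convexHull_min ?_ ((convex_convexHull ℝ _).translate_preimage_left v)
        intro y hy
        obtain ⟨g, hg, rfl⟩ := (Set.mem_fintype_sum _ _).1 hy
        apply subset_convexHull
        refine ⟨fun i => if g i = 0 then -1 else 1, fun i => ?_, ?_⟩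
        · by_cases h : g i = 0 <;> simp [h]
        · rw [add_assoc, ← Finset.sum_add_distrib, add_comm]
          congr 1
          refine Finset.sum_congr rfl fun i _ => ?_
          beta_reduce
          rcases hg i with h | h
          · rw [if_pos h, h]; module
          · have h' : g i = b i := h
            have h0 : g i ≠ 0 := by rw [h']; exact b.ne_zero i
            rw [if_neg h0, h']; module
      have := h2 h1
      simpa using this
    · refine convexHull_min ?_ hconv
      rintro _ ⟨ε, hε, rfl⟩
      have := hS (Finset.univ.filter fun i => ε i = 1)
      convert this using 1
      rw [add_assoc, ← Finset.sum_add_distrib, Finset.sum_filter]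
      congr 1
      refine Finset.sum_congr rfl fun i _ => ?_
      rcases hε i with h | h
      · rw [if_pos h, h]; module
      · rw [if_neg (by rw [h]; norm_num), h]; module
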